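/- The group given by the presentation ⟨q, r, d | q², r², (qr)², (qd)², rdrd⁻¹⟩ is isomorphic to the direct product of the cyclic group of order 2 with the infinite dihedral group. Concretely: the quotient of the free group on three generators q, r, d by the normal closure of the set of relators {q², r², (qr)², (qd)², rdrd⁻¹} is isomorphic as a group to (ℤ/2ℤ) × D∞. -/

import Mathlib

/-- The three generators `q`, `r`, `d` of the extended mapping class group
of the solid torus. -/
inductive SolidTorusGen : Type
  | q : SolidTorusGen
  | r : SolidTorusGen
  | d : SolidTorusGen

open FreeGroup SolidTorusGen in
/-- The relators `q², r², (qr)², (qd)², rdrd⁻¹`. -/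
def solidTorusRels : Set (FreeGroup SolidTorusGen) :=
  {of q ^ 2, of r ^ 2, (of q * of r) ^ 2, (of q * of d) ^ 2,
    of r * of d * of r * (of d)⁻¹}

/-- The homomorphism out of the infinite dihedral group determined by an involution `x` and an
element `y` that `x` inverts by conjugation. -/
def infiniteDihedralLift {G : Type*} [Group G] (x y : G) (hx : x * x = 1)
    (hxy : x * y * x⁻¹ = y⁻¹) : DihedralGroup 0 →* G :=
  have zpow_mul_eq (i : ℤ) : y ^ i * x = x * y ^ (-i) := by
    have h := conj_zpow (i := -i) (a := x) (b := y)
    rw [hxy, inv_zpow', neg_neg] at h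
    exact eq_mul_inv_iff_mul_eq.mp h
  MonoidHom.mk'
    (fun
      | .r i => y ^ (show ℤ from i)
      | .sr i => x * y ^ (show ℤ from i))
    (by
      rintro (i | i) (j | j)
      · exact zpow_add y (show ℤ from i) (show ℤ from j)
      · change x * y ^ ((show ℤ from j) - (show ℤ from i)) = y ^ (show ℤ from i) * (x * y ^ _)
        rw [← mul_assoc, zpow_mul_eq, mul_assoc, ← zpow_add, sub_eq_neg_add]
      · change x * y ^ ((show ℤ from i) + (show ℤ from j)) = x * y ^ (show ℤ from i) * y ^ _
        rw [zpow_add, mul_assoc]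
      · change y ^ ((show ℤ from j) - (show ℤ from i)) = x * y ^ (show ℤ from i) * (x * y ^ _)
        rw [mul_assoc, ← mul_assoc (y ^ _), zpow_mul_eq, mul_assoc, ← zpow_add, ← mul_assoc, hx,
          one_mul, sub_eq_neg_add])

theorem infiniteDihedralLift_r_one {G : Type*} [Group G] (x y : G) (hx : x * x = 1)
    (hxy : x * y * x⁻¹ = y⁻¹) : infiniteDihedralLift x y hx hxy (.r 1) = y :=
  zpow_one y

theorem infiniteDihedralLift_sr_zero {G : Type*} [Group G] (x y : G) (hx : x * x = 1)
    (hxy : x * y * x⁻¹ = y⁻¹) : infiniteDihedralLift x y hx hxy (.sr 0) = x :=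
  (congrArg (x * ·) (zpow_zero y)).trans (mul_one x)

/-- Homomorphisms out of the infinite dihedral group agree if they agree on a reflection and on
the generating rotation. -/
theorem infiniteDihedral_hom_ext {G : Type*} [Group G] {f g : DihedralGroup 0 →* G}
    (hr : f (.r 1) = g (.r 1)) (hsr : f (.sr 0) = g (.sr 0)) : f = g := by
  have rotation (i : ℤ) : f (.r i) = g (.r i) := by
    have h : (.r i : DihedralGroup 0) = .r 1 ^ i := by
      rw [DihedralGroup.r_one_zpow]; rfl
    rw [h, map_zpow, map_zpow, hr]
  ext (i | i)
  · exact rotation i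
  · have h : (.sr i : DihedralGroup 0) = .sr 0 * .r i := by simp
    rw [h, map_mul, map_mul, hsr]
    exact congrArg _ (rotation i)

/-- The homomorphism out of the cyclic group of order two determined by an involution. -/
def zmodTwoLift {G : Type*} [Group G] (x : G) (hx : x * x = 1) : Multiplicative (ZMod 2) →* G :=
  AddMonoidHom.toMultiplicativeLeft
    (ZMod.lift 2 ⟨zmultiplesHom (Additive G) (Additive.ofMul x), by
      simpa [two_zsmul] using congrArg Additive.ofMul hx⟩)

theorem zmodTwoLift_ofAdd_one {G : Type*} [Group G] (x : G) (hx : x * x = 1) :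
    zmodTwoLift x hx (.ofAdd 1) = x := by
  have h := ZMod.lift_coe 2 (⟨zmultiplesHom (Additive G) (Additive.ofMul x), by
      simpa [two_zsmul] using congrArg Additive.ofMul hx⟩ : {f : ℤ →+ Additive G // f 2 = 0}) 1
  exact (congrArg Additive.toMul h).trans (zpow_one x)

theorem zmodTwo_eq_one_or_eq_ofAdd_one (a : Multiplicative (ZMod 2)) :
    a = 1 ∨ a = .ofAdd 1 := by
  revert a; decide

/-- Homomorphisms out of the cyclic group of order two agree if they agree on its generator. -/
theorem zmodTwo_hom_ext {G : Type*} [Group G] {f g : Multiplicative (ZMod 2) →* G}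
    (h : f (.ofAdd 1) = g (.ofAdd 1)) : f = g := by
  refine MonoidHom.ext fun a => ?_
  obtain rfl | rfl := zmodTwo_eq_one_or_eq_ofAdd_one a
  · simp
  · exact h

namespace SolidTorusGen

/-- The images of the generators in the direct product. -/
def toProd : SolidTorusGen → Multiplicative (ZMod 2) × DihedralGroup 0
  | q => (1, .sr 0)
  | r => (.ofAdd 1, 1)
  | d => (1, .r 1)

theorem lift_toProd_eq_one : ∀ w ∈ solidTorusRels, FreeGroup.lift toProd w = 1 := by
  have h : (Multiplicative.ofAdd 1 * .ofAdd 1 : Multiplicative (ZMod 2)) = 1 := by decide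
  rintro w (rfl | rfl | rfl | rfl | rfl) <;> simp [toProd, pow_two, h]

/-- A generator, as an element of the presented group. -/
abbrev gen (x : SolidTorusGen) : PresentedGroup solidTorusRels := .of x

theorem gen_q_mul_self : gen q * gen q = 1 := by
  rw [← pow_two]
  exact PresentedGroup.one_of_mem (rels := solidTorusRels) (x := .of q ^ 2)
    (by simp [solidTorusRels])

theorem gen_r_mul_self : gen r * gen r = 1 := by
  rw [← pow_two]
  exact PresentedGroup.one_of_mem (rels := solidTorusRels) (x := .of r ^ 2)
    (by simp [solidTorusRels])

theorem commute_gen_r_q : Commute (gen r) (gen q) := by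
  have h : (gen q * gen r) ^ 2 = 1 :=
    PresentedGroup.one_of_mem (rels := solidTorusRels) (x := (.of q * .of r) ^ 2)
      (by simp [solidTorusRels])
  have hinv := mul_eq_one_iff_eq_inv.mp ((pow_two _).symm.trans h)
  rw [mul_inv_rev, inv_eq_of_mul_eq_one_left gen_q_mul_self,
    inv_eq_of_mul_eq_one_left gen_r_mul_self] at hinv
  exact hinv.symm

theorem conj_gen_q_d : gen q * gen d * (gen q)⁻¹ = (gen d)⁻¹ := by
  have h : (gen q * gen d) ^ 2 = 1 :=
    PresentedGroup.one_of_mem (rels := solidTorusRels) (x := (.of q * .of d) ^ 2)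
      (by simp [solidTorusRels])
  rw [inv_eq_of_mul_eq_one_left gen_q_mul_self, eq_inv_iff_mul_eq_one, ← h, pow_two, mul_assoc]

theorem commute_gen_r_d : Commute (gen r) (gen d) := by
  have h : gen r * gen d * gen r * (gen d)⁻¹ = 1 :=
    PresentedGroup.one_of_mem (rels := solidTorusRels) (x := .of r * .of d * .of r * (.of d)⁻¹)
      (by simp [solidTorusRels])
  have hinv := eq_mul_inv_of_mul_eq (mul_inv_eq_one.mp h)
  rwa [inv_eq_of_mul_eq_one_left gen_r_mul_self] at hinv

/-- The homomorphism from the infinite dihedral group onto the subgroup generated by `q`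
and `d`. -/
def ofDihedral : DihedralGroup 0 →* PresentedGroup solidTorusRels :=
  infiniteDihedralLift (gen q) (gen d) gen_q_mul_self conj_gen_q_d

/-- The homomorphism from the cyclic group of order two onto the subgroup generated by `r`. -/
def ofZModTwo : Multiplicative (ZMod 2) →* PresentedGroup solidTorusRels :=
  zmodTwoLift (gen r) gen_r_mul_self

theorem commute_gen_r_ofDihedral (b : DihedralGroup 0) : Commute (gen r) (ofDihedral b) := by
  obtain i | i := b
  · exact commute_gen_r_d.zpow_right _
  · exact commute_gen_r_q.mul_right (commute_gen_r_d.zpow_right _)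

theorem commute_ofZModTwo_ofDihedral (a : Multiplicative (ZMod 2)) (b : DihedralGroup 0) :
    Commute (ofZModTwo a) (ofDihedral b) := by
  obtain rfl | rfl := zmodTwo_eq_one_or_eq_ofAdd_one a
  · simp
  · rw [ofZModTwo, zmodTwoLift_ofAdd_one]
    exact commute_gen_r_ofDihedral b

end SolidTorusGen

/-- The group presented by `⟨q, r, d ∣ q², r², (qr)², (qd)², rdrd⁻¹⟩` is isomorphic
to the direct product of the cyclic group of order two and the infinite dihedral
group. -/
theorem presentedGroup_iso_zmodTwo_prod_infiniteDihedral :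
    Nonempty (PresentedGroup solidTorusRels ≃*
      Multiplicative (ZMod 2) × DihedralGroup 0) := by
  refine ⟨MonoidHom.toMulEquiv (PresentedGroup.toGroup SolidTorusGen.lift_toProd_eq_one)
    (SolidTorusGen.ofZModTwo.noncommCoprod SolidTorusGen.ofDihedral
      SolidTorusGen.commute_ofZModTwo_ofDihedral) ?_ ?_⟩
  · refine PresentedGroup.ext fun x => ?_
    cases x <;> simp [SolidTorusGen.toProd, SolidTorusGen.ofZModTwo, SolidTorusGen.ofDihedral,
      infiniteDihedralLift_r_one, infiniteDihedralLift_sr_zero, zmodTwoLift_ofAdd_one]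
  · rw [MonoidHom.comp_noncommCoprod, ← MonoidHom.noncommCoprod_inl_inr]
    congr 1
    · apply zmodTwo_hom_ext
      simp [SolidTorusGen.ofZModTwo, zmodTwoLift_ofAdd_one, SolidTorusGen.toProd]
    · apply infiniteDihedral_hom_ext <;>
        simp [SolidTorusGen.ofDihedral, infiniteDihedralLift_r_one,
          infiniteDihedralLift_sr_zero, SolidTorusGen.toProd]
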